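/- arXiv:2010.09837 — 8 statements merged into one kernel-verified Lean document; each statement's English description precedes it below -/
import Mathlib

section
/- Let n ≥ 0 and let h : R_n → R_n be a rack endomorphism of the free rack on n generators. Then h is a categorical inner automorphism if and only if h is an algebraic inner automorphism, i.e. there exist p, m ≥ 0, signs δ_1, …, δ_p, ε_1, …, ε_m ∈ {1, −1} and elements r_1, …, r_m ∈ R_n such that h(r) = r ◁^{δ_1} r ◁^{δ_2} … ◁^{δ_p} r ◁^{ε_1} r_1 ◁^{ε_2} … ◁^{ε_m} r_m (left-associated) for all r ∈ R_n. -/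
/-- A rack: a set with binary operations `act` (`◁`) and `invAct` (`◁⁻¹`)
satisfying self-distributivity of `◁` and of `◁⁻¹` and the two cancellation
laws `(a ◁ b) ◁⁻¹ b = a` and `(a ◁⁻¹ b) ◁ b = a`.  (The operations act on the
right, matching the conventions `g ◁ h = h⁻¹·g·h` of the free models; with
this convention, self-distributivity reads `(a ◁ b) ◁ c = (a ◁ c) ◁ (b ◁ c)`.) -/
structure RackS (α : Type) where
  act : α → α → α
  invAct : α → α → α
  self_distrib : ∀ a b c, act (act a b) c = act (act a c) (act b c)
  self_distrib_inv : ∀ a b c, invAct (invAct a b) c = invAct (invAct a c) (invAct b c)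
  act_invAct : ∀ a b, invAct (act a b) b = a
  invAct_act : ∀ a b, act (invAct a b) b = a

/-- A quandle: a rack which moreover satisfies `a ◁ a = a` and `a ◁⁻¹ a = a`. -/
structure QuandleS (α : Type) extends RackS α where
  act_self : ∀ a, act a a = a
  invAct_self : ∀ a, invAct a a = a

/-- The left-associated chain `a ◁^{ε₁} b₁ ◁^{ε₂} ⋯ ◁^{εₘ} bₘ` in a rack,
where the list consists of the pairs `(bⱼ, εⱼ)` (`true` codes the exponent
`+1`, i.e. `◁`, and `false` codes `-1`, i.e. `◁⁻¹`). -/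
def RackS.chainAct {α : Type} (q : RackS α) (a : α) : List (α × Bool) → α
  | [] => a
  | p :: l => q.chainAct (if p.2 then q.act a p.1 else q.invAct a p.1) l

/-- A rack homomorphism: a map preserving `◁` and `◁⁻¹`. -/
def IsRackHom {α β : Type} (qa : RackS α) (qb : RackS β) (f : α → β) : Prop :=
  (∀ a b, f (qa.act a b) = qb.act (f a) (f b)) ∧
  (∀ a b, f (qa.invAct a b) = qb.invAct (f a) (f b))

/-- A quandle homomorphism: a map preserving `◁` and `◁⁻¹`. -/
def IsQuandleHom {α β : Type} (qa : QuandleS α) (qb : QuandleS β) (f : α → β) : Prop :=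
  IsRackHom qa.toRackS qb.toRackS f

/-- A word (a finite list of pairs (generator, exponent `±1`), where `true`
codes `+1` and `false` codes `-1`) is reduced when it contains no adjacent pair
`(a, ε), (a, -ε)`. -/
def ReducedWord {X : Type} (w : List (X × Bool)) : Prop :=
  w.Chain' fun p q => p.1 = q.1 → p.2 = q.2

/-- The carrier of the free rack `Rₙ` on `n` generators:
`Fin n × FreeGroup (Fin n)`. -/
def FreeRckC (n : ℕ) : Type := Fin n × FreeGroup (Fin n)

/-- The free rack `Rₙ` on `n` generators, with operations
`(a, s) ◁ (b, t) = (a, s·t⁻¹·b·t)` and `(a, s) ◁⁻¹ (b, t) = (a, s·t⁻¹·b⁻¹·t)`. -/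
def freeRck (n : ℕ) : RackS (FreeRckC n) where
  act a b := (a.1, a.2 * b.2⁻¹ * FreeGroup.of b.1 * b.2)
  invAct a b := (a.1, a.2 * b.2⁻¹ * (FreeGroup.of b.1)⁻¹ * b.2)
  self_distrib a b c := Prod.ext rfl (by show _ * _ * _ * _ = _ * _ * _ * _; group)
  self_distrib_inv a b c := Prod.ext rfl (by show _ * _ * _ * _ = _ * _ * _ * _; group)
  act_invAct a b := Prod.ext rfl (by show _ * _ * _ * _ = _; group)
  invAct_act a b := Prod.ext rfl (by show _ * _ * _ * _ = _; group)

/-- The generator `yᵢ = (i, 1)` of the free rack `Rₙ`. -/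
def yR (n : ℕ) (i : Fin n) : FreeRckC n := (i, 1)

/-- A natural family of automorphisms over the free rack `Rₙ`: an assignment,
to each rack `R` and each rack homomorphism `h : Rₙ → R`, of a bijective rack
endomorphism `π_h : R → R`, natural in the sense that
`f ∘ π_h = π_{f ∘ h} ∘ f` for all rack homomorphisms `h : Rₙ → R` and
`f : R → R'`. -/
def IsNaturalFamilyR (n : ℕ)
    (π : ∀ (R : Type) (q : RackS R), (FreeRckC n → R) → R → R) : Prop :=
  (∀ (R : Type) (q : RackS R) (h : FreeRckC n → R), IsRackHom (freeRck n) q h →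
      IsRackHom q q (π R q h) ∧ Function.Bijective (π R q h)) ∧
  (∀ (R : Type) (q : RackS R) (R' : Type) (q' : RackS R')
      (h : FreeRckC n → R) (f : R → R'),
      IsRackHom (freeRck n) q h → IsRackHom q q' f →
      f ∘ π R q h = π R' q' (f ∘ h) ∘ f)

/-- An endomorphism `h₀ : Rₙ → Rₙ` is a categorical inner automorphism iff some
natural family of automorphisms `π` over `Rₙ` satisfies `π_{id} = h₀`. -/
def IsCatInnerR (n : ℕ) (h0 : FreeRckC n → FreeRckC n) : Prop :=
  ∃ π, IsNaturalFamilyR n π ∧ π (FreeRckC n) (freeRck n) id = h0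

namespace FRAux

def IsAut {R : Type} (q : RackS R) (f : R → R) : Prop :=
  IsRackHom q q f ∧ Function.Bijective f

lemma IsAut.comp {R : Type} {q : RackS R} {f g : R → R} (hg : IsAut q g) (hf : IsAut q f) :
    IsAut q (fun x => g (f x)) :=
  ⟨⟨fun a b => by simp only [hf.1.1, hg.1.1], fun a b => by simp only [hf.1.2, hg.1.2]⟩, hg.2.comp hf.2⟩

lemma act_inj {R : Type} (q : RackS R) {a b c : R} (h : q.act a c = q.act b c) : a = b := by
  rw [← q.act_invAct a c, h, q.act_invAct]

lemma aut_of {R : Type} (q : RackS R) (f g : R → R)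
    (hf : ∀ a b, f (q.act a b) = q.act (f a) (f b))
    (h1 : ∀ x, g (f x) = x) (h2 : ∀ x, f (g x) = x) : IsAut q f ∧ IsAut q g := by
  have hfi : ∀ a b, f (q.invAct a b) = q.invAct (f a) (f b) := by
    intro a b
    apply act_inj q (c := f b)
    rw [← hf, q.invAct_act, q.invAct_act]
  have bf : Function.Bijective f := ⟨Function.LeftInverse.injective h1, fun x => ⟨_, h2 x⟩⟩
  have bg : Function.Bijective g := ⟨Function.LeftInverse.injective h2, fun x => ⟨_, h1 x⟩⟩
  refine ⟨⟨⟨hf, hfi⟩, bf⟩, ⟨⟨fun a b => ?_, fun a b => ?_⟩, bg⟩⟩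
  · apply bf.1; rw [h2, hf, h2, h2]
  · apply bf.1; rw [h2, hfi, h2, h2]

lemma aut_right {R : Type} (q : RackS R) (c : R) :
    IsAut q (fun x => q.act x c) ∧ IsAut q (fun x => q.invAct x c) :=
  aut_of q _ _ (fun a b => q.self_distrib a b c) (fun x => q.act_invAct x c)
    (fun x => q.invAct_act x c)

lemma act_sq {R : Type} (q : RackS R) (x r : R) : q.act x (q.act r r) = q.act x r := by
  have := q.self_distrib (q.invAct x r) r r
  rw [q.invAct_act] at this
  exact this.symm

lemma act_isq {R : Type} (q : RackS R) (x r : R) : q.act x (q.invAct r r) = q.act x r := by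
  have := q.self_distrib x (q.invAct r r) r
  rw [q.invAct_act] at this
  exact act_inj q this

lemma invAct_sq {R : Type} (q : RackS R) (x r : R) : q.invAct x (q.act r r) = q.invAct x r := by
  apply act_inj q (c := r)
  rw [← act_sq, q.invAct_act, q.invAct_act]

lemma invAct_isq {R : Type} (q : RackS R) (x r : R) :
    q.invAct x (q.invAct r r) = q.invAct x r := by
  apply act_inj q (c := r)
  rw [← act_isq, q.invAct_act, q.invAct_act]

lemma aut_sq {R : Type} (q : RackS R) :
    IsAut q (fun x => q.act x x) ∧ IsAut q (fun x => q.invAct x x) := by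
  refine aut_of q _ _ (fun a b => ?_) (fun x => ?_) (fun x => ?_)
  · rw [act_sq q _ b, ← q.self_distrib]
  · show q.invAct (q.act x x) (q.act x x) = x
    rw [invAct_sq, q.act_invAct]
  · show q.act (q.invAct x x) (q.invAct x x) = x
    rw [act_isq, q.invAct_act]

lemma chain_append {R : Type} (q : RackS R) (l m : List (R × Bool)) (a : R) :
    q.chainAct a (l ++ m) = q.chainAct (q.chainAct a l) m := by
  induction l generalizing a with
  | nil => rfl
  | cons p l ih => exact ih _

lemma aut_chain {R : Type} (q : RackS R) (l : List (R × Bool)) :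
    IsAut q (fun x => q.chainAct x l) := by
  induction l with
  | nil => exact ⟨⟨fun _ _ => rfl, fun _ _ => rfl⟩, Function.bijective_id⟩
  | cons p l ih =>
    obtain ⟨p, _ | _⟩ := p
    · exact ih.comp (aut_right q p).2
    · exact ih.comp (aut_right q p).1

lemma chain_sq {R : Type} (q : RackS R) (ds : List Bool) (x r : R) :
    q.chainAct x (ds.map fun d => (q.act r r, d)) = q.chainAct x (ds.map fun d => (r, d)) := by
  induction ds generalizing x with
  | nil => rfl
  | cons d ds ih =>
    simp only [List.map_cons, RackS.chainAct, act_sq, invAct_sq, ih]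

lemma chain_isq {R : Type} (q : RackS R) (ds : List Bool) (x r : R) :
    q.chainAct x (ds.map fun d => (q.invAct r r, d)) = q.chainAct x (ds.map fun d => (r, d)) := by
  induction ds generalizing x with
  | nil => rfl
  | cons d ds ih =>
    simp only [List.map_cons, RackS.chainAct, act_isq, invAct_isq, ih]

lemma aut_self {R : Type} (q : RackS R) (ds : List Bool) :
    IsAut q (fun x => q.chainAct x (ds.map fun d => (x, d))) := by
  induction ds with
  | nil => exact ⟨⟨fun _ _ => rfl, fun _ _ => rfl⟩, Function.bijective_id⟩
  | cons d ds ih =>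
    cases d
    · have := ih.comp (aut_sq q).2
      simp only [chain_isq] at this
      exact this
    · have := ih.comp (aut_sq q).1
      simp only [chain_sq] at this
      exact this

lemma map_chain {R R' : Type} {q : RackS R} {q' : RackS R'} {f : R → R'} (hf : IsRackHom q q' f)
    (l : List (R × Bool)) (x : R) :
    f (q.chainAct x l) = q'.chainAct (f x) (l.map fun p => (f p.1, p.2)) := by
  induction l generalizing x with
  | nil => rfl
  | cons p l ih =>
    obtain ⟨p, _ | _⟩ := p
    · simp [RackS.chainAct, ih, hf.2]
    · simp [RackS.chainAct, ih, hf.1]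

lemma backward (n : ℕ) (ds : List Bool) (l : List (FreeRckC n × Bool)) :
    IsCatInnerR n (fun r => (freeRck n).chainAct r ((ds.map fun d => (r, d)) ++ l)) := by
  refine ⟨fun R q h r => q.chainAct r ((ds.map fun d => (r, d)) ++
    l.map fun p => (h p.1, p.2)), ⟨?_, ?_⟩, ?_⟩
  · intro R q h _
    simp only [chain_append]
    exact (aut_chain q (l.map fun p => (h p.1, p.2))).comp (aut_self q ds)
  · intro R q R' q' h f hh hf
    funext r
    simp [map_chain hf, Function.comp_def]
  · simp

/-- The rack on `X × G` attached to `g : X → G`. -/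
def rackG (X G : Type) [Group G] (g : X → G) : RackS (X × G) where
  act a b := (a.1, a.2 * b.2⁻¹ * g b.1 * b.2)
  invAct a b := (a.1, a.2 * b.2⁻¹ * (g b.1)⁻¹ * b.2)
  self_distrib a b c := Prod.ext rfl (by show _ * _ * _ * _ = _ * _ * _ * _; group)
  self_distrib_inv a b c := Prod.ext rfl (by show _ * _ * _ * _ = _ * _ * _ * _; group)
  act_invAct a b := Prod.ext rfl (by show _ * _ * _ * _ = _; group)
  invAct_act a b := Prod.ext rfl (by show _ * _ * _ * _ = _; group)

abbrev P (n : ℕ) : Type := Fin n × FreeGroup (Fin n)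

/-- The free rack, restated on the unfolded carrier. -/
def FR (n : ℕ) : RackS (P n) := rackG (Fin n) (FreeGroup (Fin n)) FreeGroup.of

/-- Natural families, restated on the unfolded carrier. -/
def IsNF (n : ℕ)
    (π : ∀ (R : Type) (_ : RackS R), (P n → R) → R → R) : Prop :=
  (∀ (R : Type) (q : RackS R) (h : P n → R), IsRackHom (FR n) q h →
      IsRackHom q q (π R q h) ∧ Function.Bijective (π R q h)) ∧
  (∀ (R : Type) (q : RackS R) (R' : Type) (q' : RackS R')
      (h : P n → R) (f : R → R'),
      IsRackHom (FR n) q h → IsRackHom q q' f →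
      f ∘ π R q h = π R' q' (f ∘ h) ∘ f)

/-- The group hom induced by a choice of images of the generators. -/
def phi {X G : Type} [Group G] (g : X → G) {m : ℕ} (f : Fin m → X × G) : FreeGroup (Fin m) →* G :=
  FreeGroup.lift fun i => (f i).2⁻¹ * g (f i).1 * (f i).2

/-- The rack hom induced by a choice of images of the generators. -/
def ext {X G : Type} [Group G] (g : X → G) {m : ℕ} (f : Fin m → X × G) : P m → X × G :=
  fun a => ((f a.1).1, (f a.1).2 * phi g f a.2)

lemma ext_hom {X G : Type} [Group G] (g : X → G) {m : ℕ} (f : Fin m → X × G) :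
    IsRackHom (FR m) (rackG X G g) (ext g f) := by
  constructor
  · rintro ⟨a, s⟩ ⟨b, t⟩
    simp [FR, rackG, ext, mul_assoc, phi]
  · rintro ⟨a, s⟩ ⟨b, t⟩
    simp [FR, rackG, ext, mul_assoc, phi]

lemma centralizer {α : Type} [DecidableEq α] (x : α) (N : ℕ) : ∀ g : FreeGroup α,
    g.toWord.length ≤ N →
    FreeGroup.of x * g = g * FreeGroup.of x → ∃ k : ℤ, g = FreeGroup.of x ^ k := by
  induction N with
  | zero =>
    intro g hg _
    refine ⟨0, ?_⟩
    simpa using hg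
  | succ N ih =>
    intro g hg hc
    rcases hw : g.toWord with _ | ⟨⟨y, b⟩, w⟩
    · exact ⟨0, by simpa using hw⟩
    have hgm : g = FreeGroup.mk ((y, b) :: w) := by rw [← hw, FreeGroup.mk_toWord]
    have hred : FreeGroup.IsReduced ((y, b) :: w) := hw ▸ FreeGroup.isReduced_toWord
    by_cases hy : y = x
    · subst hy
      have hwr : FreeGroup.IsReduced w := hred.infix ⟨[(y, b)], [], by simp⟩
      have hwl : (FreeGroup.mk w).toWord.length ≤ N := by
        rw [FreeGroup.toWord_mk, hwr.reduce_eq]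
        rw [hw] at hg; simpa using hg
      have hg2 : g = FreeGroup.mk [(y, b)] * FreeGroup.mk w := by
        rw [hgm, FreeGroup.mul_mk]; rfl
      have hb : ∃ e : ℤ, FreeGroup.mk [(y, b)] = FreeGroup.of y ^ e := by
        cases b
        · exact ⟨-1, by rw [zpow_neg_one]; rfl⟩
        · exact ⟨1, by rw [zpow_one]; rfl⟩
      obtain ⟨e, he⟩ := hb
      rw [he] at hg2
      obtain ⟨k, hk⟩ := ih _ hwl (by
        rw [hg2] at hc
        have h1 : FreeGroup.of y * FreeGroup.of y ^ e = FreeGroup.of y ^ e * FreeGroup.of y :=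
          (Commute.refl (FreeGroup.of y)).zpow_right e
        rw [← mul_assoc, h1, mul_assoc, mul_assoc] at hc
        exact mul_left_cancel hc)
      exact ⟨e + k, by rw [hg2, hk, zpow_add]⟩
    · exfalso
      have h1 : (FreeGroup.of x * g).toWord = (x, true) :: (y, b) :: w := by
        have : FreeGroup.of x * g = FreeGroup.mk ((x, true) :: (y, b) :: w) := by
          rw [hgm]; rfl
        rw [this, FreeGroup.toWord_mk, FreeGroup.IsReduced.reduce_eq]
        rw [FreeGroup.isReduced_cons_cons]
        exact ⟨fun h => absurd h.symm hy, hred⟩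
      have h2 : (g * FreeGroup.of x).toWord.Sublist (g.toWord ++ [(x, true)]) := by
        have := FreeGroup.toWord_mul_sublist g (FreeGroup.of x)
        rwa [FreeGroup.toWord_of] at this
      rw [← hc, h1, hw] at h2
      have := h2.eq_of_length (by simp)
      simp at this
      exact hy this.1.1.symm

/-- The element of the free group by which `b` acts. -/
def cc {n : ℕ} (b : P n) : FreeGroup (Fin n) := b.2⁻¹ * FreeGroup.of b.1 * b.2

lemma chain_word {n : ℕ} (u : FreeGroup (Fin n)) :
    ∃ l : List (P n × Bool), ∀ r : P n,
      (FR n).chainAct r l = (r.1, r.2 * u) := by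
  induction u using FreeGroup.induction_on with
  | C1 => exact ⟨[], fun r => by simp [RackS.chainAct]⟩
  | of i => exact ⟨[((i, 1), true)], fun r => by simp [RackS.chainAct, FR, rackG]⟩
  | inv_of i _ => exact ⟨[((i, 1), false)], fun r => by simp [RackS.chainAct, FR, rackG]⟩
  | mul a b ha hb =>
    obtain ⟨la, ha⟩ := ha
    obtain ⟨lb, hb⟩ := hb
    exact ⟨la ++ lb, fun r => by rw [chain_append, ha, hb]; simp [mul_assoc]⟩

lemma chain_pow {n : ℕ} (k : ℕ) (r x : P n) :
    (FR n).chainAct x ((List.replicate k true).map fun d => (r, d)) =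
      (x.1, x.2 * cc r ^ k) := by
  induction k generalizing x with
  | zero => simp [RackS.chainAct]
  | succ k ih =>
    simp only [List.replicate_succ, List.map_cons, RackS.chainAct, ih]
    simp [FR, rackG, cc, pow_succ', mul_assoc]

lemma chain_pow_neg {n : ℕ} (k : ℕ) (r x : P n) :
    (FR n).chainAct x ((List.replicate k false).map fun d => (r, d)) =
      (x.1, x.2 * (cc r)⁻¹ ^ k) := by
  induction k generalizing x with
  | zero => simp [RackS.chainAct]
  | succ k ih =>
    simp only [List.replicate_succ, List.map_cons, RackS.chainAct, ih]
    simp only [FR, rackG, cc, pow_succ']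
    simp [mul_assoc]

lemma chain_zpow {n : ℕ} (k : ℤ) : ∃ ds : List Bool, ∀ r : P n,
    (FR n).chainAct r (ds.map fun d => (r, d)) = (r.1, r.2 * cc r ^ k) := by
  obtain ⟨k, rfl | rfl⟩ := k.eq_nat_or_neg
  · exact ⟨List.replicate k true, fun r => by rw [chain_pow]; simp⟩
  · exact ⟨List.replicate k false, fun r => by rw [chain_pow_neg]; simp⟩

/-- extension of `f` by one more generator -/
lemma pi_formula {n : ℕ} {π : ∀ (R : Type) (q : RackS R), (P n → R) → R → R}
    (hπ : IsNF n π) : ∃ p : P (n + 1),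
    ∀ (X G : Type) [Group G] (g : X → G) (f : Fin n → X × G) (x : X × G),
      π (X × G) (rackG X G g) (ext g f) x = ext g (Fin.snoc (α := fun _ => X × G) f x) p := by
  let ι : P n → P (n + 1) :=
    ext (FreeGroup.of (α := Fin (n + 1))) (fun i : Fin n => (i.castSucc, 1))
  have hι : IsRackHom (FR n) (FR (n + 1)) ι := ext_hom _ _
  refine ⟨π _ (FR (n + 1)) ι (Fin.last n, 1), ?_⟩
  intro X G _ g f x
  have := hπ.2 _ (FR (n + 1)) _ (rackG X G g) ι
    (ext g (Fin.snoc (α := fun _ => X × G) f x)) hι (ext_hom _ _)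
  have h2 := congrFun this (Fin.last n, 1)
  simp only [Function.comp_apply] at h2
  rw [h2]
  have e1 : ext g (Fin.snoc (α := fun _ => X × G) f x) ∘ ι = ext g f := by
    have : (phi g (Fin.snoc (α := fun _ => X × G) f x)).comp
        (phi (FreeGroup.of (α := Fin (n + 1))) (fun i : Fin n => (i.castSucc, 1))) = phi g f := by
      apply FreeGroup.ext_hom
      intro i
      simp [phi]
    funext ⟨a, s⟩
    have := DFunLike.congr_fun this s
    simp only [MonoidHom.comp_apply] at this
    simp [ext, ι, this]
  rw [e1]
  simp [ext]

lemma forward (n : ℕ) (h : P n → P n)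
    (H : ∃ π, IsNF n π ∧ π (P n) (FR n) id = h) :
    ∃ (k : ℤ) (u : FreeGroup (Fin n)), ∀ r : P n, h r = (r.1, r.2 * cc r ^ k * u) := by
  obtain ⟨π, hπ, rfl⟩ := H
  obtain ⟨⟨b, w⟩, hp⟩ := pi_formula hπ
  -- the test rack
  let g : Option (Fin (n + 1)) → (FreeGroup (Fin (n + 1))) := fun o => o.elim 1 FreeGroup.of
  let f : Fin n → Option (Fin (n + 1)) × (FreeGroup (Fin (n + 1))) := fun i => (some i.castSucc, 1)
  have hf := hp _ (FreeGroup (Fin (n + 1))) g f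
  obtain ⟨hhom, hbij⟩ := hπ.1 _ (rackG _ (FreeGroup (Fin (n + 1))) g) (ext g f) (ext_hom _ _)
  have hb : b = Fin.last n := by
    rcases Fin.eq_castSucc_or_eq_last b with ⟨i, rfl⟩ | hb
    · exfalso
      obtain ⟨x, hx⟩ := hbij.2 (none, 1)
      rw [hf] at hx
      have := congrArg Prod.fst hx
      simp [ext, f] at this
    · exact hb
  subst hb
  have hf' : ∀ x, π _ (rackG _ (FreeGroup (Fin (n + 1))) g) (ext g f) x =
      (x.1, x.2 * phi g (Fin.snoc (α := fun _ => Option (Fin (n + 1)) × (FreeGroup (Fin (n + 1)))) f x) w) := by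
    intro x; rw [hf]; simp [ext]
  let z : (FreeGroup (Fin (n + 1))) := FreeGroup.of (Fin.last n)
  let kill : (FreeGroup (Fin (n + 1))) →* (FreeGroup (Fin (n + 1))) := phi g (Fin.snoc (α := fun _ => Option (Fin (n + 1)) × (FreeGroup (Fin (n + 1)))) f (none, 1))
  have hz : phi g (Fin.snoc (α := fun _ => Option (Fin (n + 1)) × (FreeGroup (Fin (n + 1)))) f (some (Fin.last n), 1))
      = MonoidHom.id (FreeGroup (Fin (n + 1))) := by
    apply FreeGroup.ext_hom
    intro i
    refine Fin.lastCases ?_ (fun i => ?_) i <;> simp [phi, g, f]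
  have hk : ∀ s, phi g (Fin.snoc (α := fun _ => Option (Fin (n + 1)) × (FreeGroup (Fin (n + 1)))) f (none, s)) = kill := by
    intro s
    apply FreeGroup.ext_hom
    intro i
    refine Fin.lastCases ?_ (fun i => ?_) i <;> simp [kill, phi, g, f]
  have key := hhom.1 (none, 1) (some (Fin.last n), 1)
  rw [hf', hf', hf'] at key
  simp only [rackG, hz, hk] at key
  have key2 : z * kill w = kill w * w⁻¹ * z * w := by
    have := congrArg Prod.snd key
    simpa [g, z, mul_assoc] using this
  have key3 : z * (w * (kill w)⁻¹) = (w * (kill w)⁻¹) * z := by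
    calc z * (w * (kill w)⁻¹) = w * (kill w)⁻¹ * (kill w * w⁻¹ * z * w) * (kill w)⁻¹ := by group
      _ = _ := by rw [← key2]; group
  obtain ⟨k, hk⟩ := centralizer (Fin.last n) _ _ le_rfl key3
  have hw : w = FreeGroup.of (Fin.last n) ^ k * kill w := by rw [← hk]; group
  let κ : (FreeGroup (Fin (n + 1))) →* FreeGroup (Fin n) := FreeGroup.lift
    (Fin.snoc (α := fun _ => FreeGroup (Fin n)) FreeGroup.of 1)
  refine ⟨k, κ w, fun r => ?_⟩
  have hr := hp _ (FreeGroup (Fin n)) FreeGroup.of (fun i => (i, 1)) r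
  have hid : ext (FreeGroup.of (α := Fin n)) (fun i : Fin n => (i, 1)) = id := by
    have : phi (FreeGroup.of (α := Fin n)) (fun i : Fin n => (i, 1)) = MonoidHom.id _ := by
      apply FreeGroup.ext_hom
      intro i
      simp [phi]
    funext ⟨a, s⟩
    simp [ext, this]
  rw [hid] at hr
  refine Eq.trans hr ?_
  let ψ := phi (FreeGroup.of (α := Fin n))
    (Fin.snoc (α := fun _ => Fin n × FreeGroup (Fin n)) (fun i => (i, 1)) r)
  have h1 : ψ.comp kill = κ := by
    apply FreeGroup.ext_hom
    intro i
    refine Fin.lastCases ?_ (fun i => ?_) i <;> simp [ψ, kill, κ, phi, g, f]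
  have h2 : ψ w = cc r ^ k * κ w := by
    conv_lhs => rw [hw]
    rw [map_mul, map_zpow, ← h1]
    simp [ψ, phi, cc]
  have h3 : ext (FreeGroup.of (α := Fin n))
    (Fin.snoc (α := fun _ => Fin n × FreeGroup (Fin n)) (fun i => (i, 1)) r) (Fin.last n, w)
     = (r.1, r.2 * ψ w) := by
    simp [ext, ψ]
  refine h3.trans ?_
  rw [h2, mul_assoc]

lemma forward_chain (n : ℕ) (h : P n → P n)
    (H : ∃ π, IsNF n π ∧ π (P n) (FR n) id = h) :
    ∃ (ds : List Bool) (l : List (P n × Bool)), ∀ r : P n,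
      h r = (FR n).chainAct r ((ds.map fun d => (r, d)) ++ l) := by
  obtain ⟨k, u, hu⟩ := forward n h H
  obtain ⟨ds, hds⟩ := chain_zpow (n := n) k
  obtain ⟨l, hl⟩ := chain_word u
  refine ⟨ds, l, fun r => ?_⟩
  rw [chain_append, hds, hl, hu]

end FRAux

/-- **Corollary 6.3 of the paper.** Let `h : Rₙ → Rₙ` be a rack endomorphism of
the free rack on `n` generators.  Then `h` is a categorical inner automorphism
iff `h` is an algebraic inner automorphism, i.e. there are `p, m ≥ 0`, signs
`δ₁, …, δ_p, ε₁, …, εₘ` and elements `r₁, …, rₘ ∈ Rₙ` (i.e. a list `ds` of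
signs and a list `l` of pairs) such that
`h r = r ◁^{δ₁} r ◁^{δ₂} ⋯ ◁^{δ_p} r ◁^{ε₁} r₁ ◁^{ε₂} ⋯ ◁^{εₘ} rₘ`
(left-associated) for all `r ∈ Rₙ`. -/
theorem cat_inner_iff_alg_inner_free_rack (n : ℕ) (h : FreeRckC n → FreeRckC n)
    (hh : IsRackHom (freeRck n) (freeRck n) h) :
    IsCatInnerR n h ↔
      ∃ (ds : List Bool) (l : List (FreeRckC n × Bool)),
        ∀ r : FreeRckC n,
          h r = (freeRck n).chainAct r ((ds.map fun d => (r, d)) ++ l) := by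
  constructor
  · intro H
    exact FRAux.forward_chain n h H
  · rintro ⟨ds, l, H⟩
    have : h = fun r => (freeRck n).chainAct r ((ds.map fun d => (r, d)) ++ l) := funext H
    rw [this]
    exact FRAux.backward n ds l
end

section
/- The global isotropy group of the category of racks is isomorphic to ℤ: if ψ assigns to every rack R a bijective rack endomorphism ψ_R : R → R such that f ∘ ψ_R = ψ_{R'} ∘ f for every rack homomorphism f : R → R', then there exists a unique integer z ∈ ℤ such that for every rack R and every r ∈ R, ψ_R(r) is the result of applying the map (· ◁ r) z times to r when z ≥ 0, and of applying the map (· ◁⁻¹ r) (−z) times to r when z < 0. Conversely, for every z ∈ ℤ the assignment so defined is such a natural family of bijective rack endomorphisms. -/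
/-- For an integer `z` and an element `r` of a rack: the result of applying the
map `· ◁ r` to `r` `z` times when `z ≥ 0`, and of applying the map `· ◁⁻¹ r`
to `r` `(-z)` times when `z < 0`. -/
def zApply {α : Type} (q : RackS α) (z : ℤ) (r : α) : α :=
  if 0 ≤ z then (fun x => q.act x r)^[z.toNat] r
  else (fun x => q.invAct x r)^[(-z).toNat] r

/-- Right translation as a permutation. -/
def rT {α : Type} (q : RackS α) (b : α) : Equiv.Perm α where
  toFun a := q.act a b
  invFun a := q.invAct a b
  left_inv a := q.act_invAct a b
  right_inv a := q.invAct_act a b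

theorem rT_conj {α : Type} (q : RackS α) (b c : α) :
    rT q (rT q c b) = rT q c * rT q b * (rT q c)⁻¹ := by
  rw [eq_mul_inv_iff_mul_eq]
  ext a
  exact (q.self_distrib a b c).symm

theorem rT_inv_apply {α : Type} (q : RackS α) (a b : α) :
    (rT q b)⁻¹ a = q.invAct a b := rfl

theorem zApply_eq {α : Type} (q : RackS α) (z : ℤ) (r : α) :
    zApply q z r = (rT q r ^ z) r := by
  unfold zApply
  split_ifs with h
  · obtain ⟨n, rfl⟩ := Int.eq_ofNat_of_zero_le h
    rw [zpow_natCast, ← Equiv.Perm.iterate_eq_pow]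
    rfl
  · obtain ⟨n, hn⟩ := Int.eq_ofNat_of_zero_le (a := -z) (by omega)
    obtain rfl : z = -(n : ℤ) := by omega
    rw [zpow_neg, zpow_natCast, ← inv_pow, ← Equiv.Perm.iterate_eq_pow, neg_neg]
    rfl

theorem rT_zApply {α : Type} (q : RackS α) (z : ℤ) (r : α) :
    rT q (zApply q z r) = rT q r := by
  rw [zApply_eq]
  induction z using Int.induction_on with
  | zero => simp
  | succ n ih =>
    rw [add_comm, zpow_add, zpow_one, Equiv.Perm.mul_apply, rT_conj, ih]
    simp
  | pred n ih =>
    have h := rT_conj q ((rT q r ^ (-(n : ℤ) - 1)) r) r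
    rw [← Equiv.Perm.mul_apply, ← zpow_one_add, add_sub_cancel, ih,
      eq_mul_inv_iff_mul_eq] at h
    exact (mul_left_cancel h).symm

theorem zApply_one_add {α : Type} (q : RackS α) (z : ℤ) (r : α) :
    zApply q (z + 1) r = q.act (zApply q z r) r := by
  rw [zApply_eq, zApply_eq, add_comm, zpow_add, zpow_one]
  rfl

theorem zApply_sub_one {α : Type} (q : RackS α) (z : ℤ) (r : α) :
    zApply q (z - 1) r = q.invAct (zApply q z r) r := by
  rw [← q.act_invAct (zApply q (z - 1) r) r, ← zApply_one_add, sub_add_cancel]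

theorem act_zApply {α : Type} (q : RackS α) (z : ℤ) (a r : α) :
    q.act a (zApply q z r) = q.act a r :=
  congrArg (fun e : Equiv.Perm α => e a) (rT_zApply q z r)

theorem invAct_zApply {α : Type} (q : RackS α) (z : ℤ) (a r : α) :
    q.invAct a (zApply q z r) = q.invAct a r :=
  congrArg (fun e : Equiv.Perm α => e⁻¹ a) (rT_zApply q z r)

/-- The free rack on one generator. -/
def intRack : RackS ℤ where
  act a _ := a + 1
  invAct a _ := a - 1
  self_distrib _ _ _ := rfl
  self_distrib_inv _ _ _ := rfl
  act_invAct a _ := by simp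
  invAct_act a _ := by simp

theorem zApply_intRack (z : ℤ) : zApply intRack z 0 = z := by
  induction z using Int.induction_on with
  | zero => rfl
  | succ n ih => rw [zApply_one_add, ih]; rfl
  | pred n ih => rw [zApply_sub_one, ih]; rfl

theorem intRack_hom {α : Type} (q : RackS α) (r : α) :
    IsRackHom intRack q (fun z => zApply q z r) := by
  refine ⟨fun a b => ?_, fun a b => ?_⟩
  · simp only [act_zApply]
    exact zApply_one_add q a r
  · simp only [invAct_zApply]
    exact zApply_sub_one q a r

theorem zApply_nat {α β : Type} (q : RackS α) (q' : RackS β) (f : α → β)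
    (hf : IsRackHom q q' f) (z : ℤ) (r : α) :
    f (zApply q z r) = zApply q' z (f r) := by
  induction z using Int.induction_on with
  | zero => rfl
  | succ n ih => rw [zApply_one_add, zApply_one_add, hf.1, ih]
  | pred n ih => rw [zApply_sub_one, zApply_sub_one, hf.2, ih]

theorem act_hom {α : Type} (q : RackS α) (b : α) : IsRackHom q q (fun a => q.act a b) := by
  refine ⟨fun a c => q.self_distrib a c b, fun a c => ?_⟩
  show q.act (q.invAct a c) b = _
  rw [← q.act_invAct (q.act (q.invAct a c) b) (q.act c b), ← q.self_distrib, q.invAct_act]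

theorem invAct_hom {α : Type} (q : RackS α) (b : α) :
    IsRackHom q q (fun a => q.invAct a b) := by
  refine ⟨fun a c => ?_, fun a c => q.self_distrib_inv a c b⟩
  show q.invAct (q.act a c) b = _
  rw [← q.invAct_act (q.invAct (q.act a c) b) (q.invAct c b), ← q.self_distrib_inv,
    q.act_invAct]

theorem zApply_neg {α : Type} (q : RackS α) (z : ℤ) (r : α) :
    zApply q (-z) (zApply q z r) = r := by
  rw [zApply_eq, rT_zApply, zApply_eq, ← Equiv.Perm.mul_apply, ← zpow_add]
  simp

/-- **The global isotropy group of the category of racks is `ℤ`**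
(Corollary 7 of the paper).  If `ψ` assigns to every rack `R` a bijective rack
endomorphism `ψ_R : R → R` naturally in `R` (that is, `f ∘ ψ_R = ψ_{R'} ∘ f`
for every rack homomorphism `f : R → R'`), then there is a unique integer `z`
such that `ψ_R r = r ◁ r ◁ ⋯ ◁ r` (`z` times) for `z ≥ 0`, resp.
`ψ_R r = r ◁⁻¹ r ◁⁻¹ ⋯ ◁⁻¹ r` (`-z` times) for `z < 0`, for every rack `R` and
`r ∈ R`.  Conversely, for every integer `z` this formula defines such a
natural family of bijective rack endomorphisms. -/
theorem global_isotropy_rack_int :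
    (∀ ψ : ∀ (R : Type) (q : RackS R), R → R,
      (∀ (R : Type) (q : RackS R), IsRackHom q q (ψ R q)) →
      (∀ (R : Type) (q : RackS R), Function.Bijective (ψ R q)) →
      (∀ (R : Type) (q : RackS R) (R' : Type) (q' : RackS R') (f : R → R'),
        IsRackHom q q' f → f ∘ ψ R q = ψ R' q' ∘ f) →
      ∃! z : ℤ, ∀ (R : Type) (q : RackS R) (r : R), ψ R q r = zApply q z r) ∧
    (∀ z : ℤ,
      (∀ (R : Type) (q : RackS R), IsRackHom q q (fun r => zApply q z r)) ∧
      (∀ (R : Type) (q : RackS R), Function.Bijective (fun r => zApply q z r)) ∧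
      (∀ (R : Type) (q : RackS R) (R' : Type) (q' : RackS R') (f : R → R'),
        IsRackHom q q' f →
        f ∘ (fun r => zApply q z r) = (fun r' => zApply q' z r') ∘ f)) := by
  refine ⟨fun ψ _ _ hn => ?_, fun z => ⟨fun R q => ⟨fun a b => ?_, fun a b => ?_⟩,
    fun R q => ?_, fun R q R' q' f hf => ?_⟩⟩
  · refine ⟨ψ ℤ intRack 0, fun R q r => ?_, fun y hy => ?_⟩
    · exact (congrFun (hn ℤ intRack R q _ (intRack_hom q r)) 0).symm
    · rw [hy ℤ intRack 0, zApply_intRack]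
  · rw [act_zApply]
    exact (zApply_nat q q _ (act_hom q b) z a).symm
  · rw [invAct_zApply]
    exact (zApply_nat q q _ (invAct_hom q b) z a).symm
  · refine Function.bijective_iff_has_inverse.2 ⟨fun r => zApply q (-z) r,
      fun r => zApply_neg q z r, fun r => ?_⟩
    simpa using zApply_neg q (-z) r
  · funext r
    exact zApply_nat q q' f hf z r
end

section
/- Let n ≥ 0 and let s be a reduced word over the generators {x, y_1, …, y_n}. If in the free group on the generators {x_0, x_1, y_1, …, y_n} the equality s[x_1/x] · s[x_1⁻¹·x_0·x_1/x] = s[x_0/x] · s[x_1/x] holds, then s contains at most one occurrence of the generator x, and if it contains one, that occurrence has exponent +1. -/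
/-- The generator set `{x, y₁, …, yₙ}`: `none` is the designated generator `x`
and `some i` is the generator `yᵢ`. -/
abbrev XY (n : ℕ) : Type := Option (Fin n)

/-- The generator set `{x₀, x₁, y₁, …, yₙ}`: `Sum.inl false` is `x₀`,
`Sum.inl true` is `x₁`, and `Sum.inr i` is `yᵢ`. -/
abbrev XXY (n : ℕ) : Type := Bool ⊕ Fin n

/-- The generator `x₀` of the free group on `{x₀, x₁, y₁, …, yₙ}`. -/
def fgx0 (n : ℕ) : FreeGroup (XXY n) := FreeGroup.of (Sum.inl false)

/-- The generator `x₁` of the free group on `{x₀, x₁, y₁, …, yₙ}`. -/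
def fgx1 (n : ℕ) : FreeGroup (XXY n) := FreeGroup.of (Sum.inl true)

/-- The substitution homomorphism `w ↦ w[g/x]` from the free group on
`{x, y₁, …, yₙ}` to the free group on `{x₀, x₁, y₁, …, yₙ}`, sending the
generator `x` to `g` and every generator `yᵢ` to itself. -/
def subNone (n : ℕ) (g : FreeGroup (XXY n)) :
    FreeGroup (XY n) →* FreeGroup (XXY n) :=
  FreeGroup.lift fun a => a.elim g fun i => FreeGroup.of (Sum.inr i)

/-- Elements of the subgroup generated by all generators other than `x₀`. -/
def NoX0 {n : ℕ} (h : FreeGroup (XXY n)) : Prop :=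
  ∃ v : List (XXY n × Bool), FreeGroup.IsReduced v ∧ (∀ p ∈ v, p.1 ≠ Sum.inl false) ∧
    h = FreeGroup.mk v

/-- Elements whose reduced word begins with `x₀ ^ e`. -/
def Beg {n : ℕ} (e : Bool) (w : FreeGroup (XXY n)) : Prop :=
  ∃ u : List (XXY n × Bool), FreeGroup.IsReduced ((Sum.inl false, e) :: u) ∧
    w = FreeGroup.mk ((Sum.inl false, e) :: u)

theorem noX0_mk {n : ℕ} (v : List (XXY n × Bool)) (hv : ∀ p ∈ v, p.1 ≠ Sum.inl false) :
    NoX0 (FreeGroup.mk v) := by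
  refine ⟨FreeGroup.reduce v, FreeGroup.isReduced_iff_reduce_eq.2 FreeGroup.reduce.idem, ?_,
    FreeGroup.reduce.self.symm⟩
  intro p hp
  exact hv p ((FreeGroup.Red.sublist FreeGroup.reduce.red).subset hp)

theorem NoX0.mul {n : ℕ} {g h : FreeGroup (XXY n)} (hg : NoX0 g) (hh : NoX0 h) :
    NoX0 (g * h) := by
  obtain ⟨u, -, hu, rfl⟩ := hg
  obtain ⟨v, -, hv, rfl⟩ := hh
  rw [FreeGroup.mul_mk]
  apply noX0_mk
  intro p hp
  rcases List.mem_append.1 hp with h | h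
  · exact hu p h
  · exact hv p h

theorem NoX0.inv {n : ℕ} {g : FreeGroup (XXY n)} (hg : NoX0 g) : NoX0 g⁻¹ := by
  obtain ⟨u, -, hu, rfl⟩ := hg
  rw [FreeGroup.inv_mk]
  apply noX0_mk
  intro p hp
  simp only [FreeGroup.invRev, List.mem_reverse, List.mem_map] at hp
  obtain ⟨q, hq, rfl⟩ := hp
  exact hu q hq

theorem noX0_one {n : ℕ} : NoX0 (1 : FreeGroup (XXY n)) := noX0_mk [] (by simp)

theorem noX0_x1 {n : ℕ} : NoX0 (fgx1 n) := noX0_mk [(Sum.inl true, true)] (by simp)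

theorem mk_cons' {X : Type} (p : X × Bool) (L : List (X × Bool)) :
    FreeGroup.mk (p :: L) = FreeGroup.mk [p] * FreeGroup.mk L := by
  rw [FreeGroup.mul_mk]; rfl

theorem sub_noX0 {n : ℕ} {g : FreeGroup (XXY n)} (hg : NoX0 g) (L : List (XY n × Bool)) :
    NoX0 (subNone n g (FreeGroup.mk L)) := by
  induction L with
  | nil => simpa [FreeGroup.one_eq_mk.symm] using noX0_one
  | cons p L ih =>
    rw [mk_cons', map_mul]
    refine NoX0.mul ?_ ih
    obtain ⟨a, b⟩ := p
    have key : NoX0 (a.elim g fun i => FreeGroup.of (Sum.inr i)) := by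
      cases a with
      | none => exact hg
      | some i => exact noX0_mk [(Sum.inr i, true)] (by simp)
    cases b
    · simpa [subNone] using key.inv
    · simpa [subNone] using key

theorem sub_indep {n : ℕ} (g g' : FreeGroup (XXY n)) (A : List (XY n × Bool))
    (hA : ∀ p ∈ A, p.1 ≠ none) :
    subNone n g (FreeGroup.mk A) = subNone n g' (FreeGroup.mk A) := by
  induction A with
  | nil => simp [FreeGroup.one_eq_mk.symm]
  | cons p L ih =>
    rw [mk_cons', map_mul, map_mul, ih (fun q hq => hA q (by simp [hq]))]
    congr 1
    obtain ⟨a, b⟩ := p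
    cases a with
    | none => exact absurd rfl (hA (none, b) (by simp))
    | some i => simp [subNone]

/-- Retraction sending `x₁` (and `x₀`) to `x`. -/
def retr (n : ℕ) : FreeGroup (XXY n) →* FreeGroup (XY n) :=
  FreeGroup.lift fun a => a.elim (fun _ => FreeGroup.of none) fun i => FreeGroup.of (some i)

theorem retr_sub {n : ℕ} (w : FreeGroup (XY n)) : retr n (subNone n (fgx1 n) w) = w := by
  have : (retr n).comp (subNone n (fgx1 n)) = MonoidHom.id _ := by
    ext a
    cases a <;> simp [retr, subNone, fgx1]
  exact DFunLike.congr_fun this w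

/-- Conjugated substitution. -/
def phi (n : ℕ) (c : FreeGroup (XXY n)) (w : FreeGroup (XY n)) : FreeGroup (XXY n) :=
  c * subNone n (c⁻¹ * fgx0 n * c) w * c⁻¹

theorem phi_mul {n : ℕ} (c : FreeGroup (XXY n)) (v w : FreeGroup (XY n)) :
    phi n c (v * w) = phi n c v * phi n c w := by
  simp only [phi, map_mul]; group

theorem phi_x {n : ℕ} (c : FreeGroup (XXY n)) (e : Bool) :
    phi n c (FreeGroup.mk [(none, e)]) = FreeGroup.mk [(Sum.inl false, e)] := by
  have h0 : fgx0 n = FreeGroup.mk [(Sum.inl false, true)] := rfl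
  cases e
  · have : (FreeGroup.mk [(Sum.inl false, false)] : FreeGroup (XXY n)) = (fgx0 n)⁻¹ := by
      rw [h0, FreeGroup.inv_mk]; rfl
    rw [this]
    simp [phi, subNone, mul_assoc]
  · rw [← h0]
    simp [phi, subNone, mul_assoc]

theorem Beg.cons_self {n : ℕ} {e : Bool} {w : FreeGroup (XXY n)} (hw : Beg e w) :
    Beg e (FreeGroup.mk [(Sum.inl false, e)] * w) := by
  obtain ⟨u, hu, rfl⟩ := hw
  refine ⟨(Sum.inl false, e) :: u, ?_, (mk_cons' _ _).symm⟩
  exact List.IsChain.cons_cons (by simp) hu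

theorem beg_noX0 {n : ℕ} (e : Bool) {h : FreeGroup (XXY n)} (hh : NoX0 h) :
    Beg e (FreeGroup.mk [(Sum.inl false, e)] * h) := by
  obtain ⟨v, hv, hv0, rfl⟩ := hh
  refine ⟨v, ?_, (mk_cons' _ _).symm⟩
  cases v with
  | nil => exact List.isChain_singleton _
  | cons p v =>
    exact List.IsChain.cons_cons (fun hp => absurd hp.symm (hv0 p (by simp))) hv

theorem red_append {n : ℕ} {v : List (XXY n × Bool)} {e : Bool} {u : List (XXY n × Bool)}
    (hv : FreeGroup.IsReduced v) (hv0 : ∀ p ∈ v, p.1 ≠ Sum.inl false)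
    (hu : FreeGroup.IsReduced ((Sum.inl false, e) :: u)) :
    FreeGroup.IsReduced (v ++ (Sum.inl false, e) :: u) := by
  refine List.IsChain.append hv hu ?_
  intro p hp q hq
  simp at hq
  subst hq
  intro h
  exact absurd h (hv0 p (List.mem_of_mem_getLast? hp))

theorem beg_step {n : ℕ} (e e' : Bool) {h w : FreeGroup (XXY n)} (hh : NoX0 h) (h1 : h ≠ 1)
    (hw : Beg e' w) : Beg e (FreeGroup.mk [(Sum.inl false, e)] * (h * w)) := by
  obtain ⟨v, hv, hv0, rfl⟩ := hh
  obtain ⟨u, hu, rfl⟩ := hw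
  refine ⟨v ++ (Sum.inl false, e') :: u, ?_, ?_⟩
  · cases v with
    | nil => exact absurd FreeGroup.one_eq_mk.symm h1
    | cons p v =>
      exact List.IsChain.cons_cons (fun hp => absurd hp.symm (hv0 p (by simp)))
        (red_append hv hv0 hu)
  · rw [FreeGroup.mul_mk, ← mk_cons']

theorem beg_unique {n : ℕ} {e : Bool} {g h w w' : FreeGroup (XXY n)} (hg : NoX0 g) (hh : NoX0 h)
    (hw : Beg e w) (hw' : Beg e w') (heq : g * w = h * w') : g = h := by
  obtain ⟨a, ha, ha0, rfl⟩ := hg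
  obtain ⟨b, hb, hb0, rfl⟩ := hh
  obtain ⟨u, hu, rfl⟩ := hw
  obtain ⟨u', hu', rfl⟩ := hw'
  rw [FreeGroup.mul_mk, FreeGroup.mul_mk] at heq
  have h2 := congrArg FreeGroup.toWord heq
  rw [FreeGroup.toWord_mk, FreeGroup.toWord_mk,
    (red_append ha ha0 hu).reduce_eq, (red_append hb hb0 hu').reduce_eq] at h2
  have tk : ∀ (v t : List (XXY n × Bool)), (∀ p ∈ v, p.1 ≠ Sum.inl false) →
      (v ++ (Sum.inl false, e) :: t).takeWhile (fun p => decide (p.1 ≠ Sum.inl false)) = v := by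
    intro v t hv
    rw [List.takeWhile_append_of_pos (by simpa using hv)]
    simp
  have h3 := congrArg (List.takeWhile (fun p => decide (p.1 ≠ Sum.inl false))) h2
  rw [tk a u ha0, tk b u' hb0] at h3
  rw [h3]

theorem split_none {n : ℕ} (L : List (XY n × Bool)) :
    (∀ p ∈ L, p.1 ≠ none) ∨ ∃ A e T, L = A ++ (none, e) :: T ∧ ∀ p ∈ A, p.1 ≠ none := by
  induction L with
  | nil => left; simp
  | cons p L ih =>
    obtain ⟨a, b⟩ := p
    cases a with
    | none => right; exact ⟨[], b, L, rfl, by simp⟩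
    | some i =>
      rcases ih with h | ⟨A, e, T, rfl, hA⟩
      · left; simpa using h
      · right; exact ⟨(some i, b) :: A, e, T, rfl, by simpa using hA⟩

theorem phi_noX0 {n : ℕ} {c : FreeGroup (XXY n)} (hc : NoX0 c) (A : List (XY n × Bool))
    (hA : ∀ p ∈ A, p.1 ≠ none) : NoX0 (phi n c (FreeGroup.mk A)) := by
  rw [phi, sub_indep _ (fgx1 n) A hA]
  exact (hc.mul (sub_noX0 noX0_x1 A)).mul hc.inv

theorem phi_ne_one {n : ℕ} {c : FreeGroup (XXY n)} (A : List (XY n × Bool))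
    (hA : ∀ p ∈ A, p.1 ≠ none) (hr : FreeGroup.IsReduced A) (hne : A ≠ []) :
    phi n c (FreeGroup.mk A) ≠ 1 := by
  intro h
  rw [phi, sub_indep _ (fgx1 n) A hA, conj_eq_one_iff] at h
  have h2 := congrArg (retr n) h
  rw [retr_sub, map_one] at h2
  have h3 := congrArg FreeGroup.toWord h2
  rw [FreeGroup.toWord_mk, hr.reduce_eq, FreeGroup.toWord_one] at h3
  exact hne h3

theorem beg_key {n : ℕ} {c : FreeGroup (XXY n)} (hc : NoX0 c) {h : FreeGroup (XXY n)}
    (hh : NoX0 h) (k : ℕ) : ∀ (e : Bool) (T : List (XY n × Bool)), T.length ≤ k →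
      FreeGroup.IsReduced ((none, e) :: T) →
      Beg e (phi n c (FreeGroup.mk ((none, e) :: T)) * h) := by
  induction k with
  | zero =>
    intro e T hT hr
    obtain rfl : T = [] := by simpa using hT
    rw [phi_x]
    exact beg_noX0 e hh
  | succ k ih =>
    intro e T hT hr
    rw [mk_cons', phi_mul, phi_x, mul_assoc]
    rcases split_none T with hn | ⟨A, e', R, rfl, hA⟩
    · exact beg_noX0 e ((phi_noX0 hc T hn).mul hh)
    · have hr1 : FreeGroup.IsReduced (A ++ (none, e') :: R) := List.IsChain.tail hr
      have hrA : FreeGroup.IsReduced A := List.IsChain.left_of_append hr1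
      have hrR : FreeGroup.IsReduced ((none, e') :: R) := List.IsChain.right_of_append hr1
      have hB := ih e' R (by simp at hT; omega) hrR
      by_cases hA0 : A = []
      · subst hA0
        have hee : e = e' := (List.isChain_cons_cons.1 hr).1 rfl
        subst hee
        exact hB.cons_self
      · rw [← FreeGroup.mul_mk, phi_mul, mul_assoc]
        exact beg_step e e' (phi_noX0 hc A hA) (phi_ne_one A hA hrA hA0) hB

/-- **Lemma 2 of the paper.** Let `s` be a reduced word over the generators
`{x, y₁, …, yₙ}`.  If, in the free group on `{x₀, x₁, y₁, …, yₙ}`,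
`s[x₁/x] · s[x₁⁻¹·x₀·x₁/x] = s[x₀/x] · s[x₁/x]`, then `s` has at most one
occurrence of the generator `x`, and any such occurrence has exponent `+1`. -/
theorem reduced_word_at_most_one_x (n : ℕ) (s : List (XY n × Bool))
    (hred : ReducedWord s)
    (heq : subNone n (fgx1 n) (FreeGroup.mk s) *
        subNone n ((fgx1 n)⁻¹ * fgx0 n * fgx1 n) (FreeGroup.mk s) =
      subNone n (fgx0 n) (FreeGroup.mk s) * subNone n (fgx1 n) (FreeGroup.mk s)) :
    s.countP (fun p => decide (p.1 = none)) ≤ 1 ∧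
      ∀ p ∈ s, p.1 = none → p.2 = true := by
  have hr : FreeGroup.IsReduced s := hred
  rcases split_none s with hn | ⟨A, e, T, hs, hA⟩
  · refine ⟨?_, fun p hp h => absurd h (hn p hp)⟩
    rw [List.countP_eq_zero.2 (by simpa using hn)]
    exact Nat.zero_le _
  have hsx : NoX0 (subNone n (fgx1 n) (FreeGroup.mk s)) := sub_noX0 noX0_x1 s
  have hrL : FreeGroup.IsReduced ((none, e) :: T) := by
    rw [hs] at hr
    exact List.IsChain.right_of_append hr
  have b1 := beg_key noX0_x1 noX0_x1 T.length e T le_rfl hrL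
  have b2 := beg_key noX0_one hsx T.length e T le_rfl hrL
  have hAx : NoX0 (subNone n (fgx1 n) (FreeGroup.mk A)) := sub_noX0 noX0_x1 A
  have hmk : FreeGroup.mk s = FreeGroup.mk A * FreeGroup.mk ((none, e) :: T) := by
    rw [FreeGroup.mul_mk, hs]
  have main := beg_unique ((hsx.mul hAx).mul noX0_x1.inv) hAx b1 b2 (by
    have e1 : subNone n ((fgx1 n)⁻¹ * fgx0 n * fgx1 n) (FreeGroup.mk s) =
        subNone n (fgx1 n) (FreeGroup.mk A) *
        subNone n ((fgx1 n)⁻¹ * fgx0 n * fgx1 n) (FreeGroup.mk ((none, e) :: T)) := by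
      rw [hmk, map_mul, sub_indep _ (fgx1 n) A hA]
    have e2 : subNone n (fgx0 n) (FreeGroup.mk s) =
        subNone n (fgx1 n) (FreeGroup.mk A) *
        subNone n (fgx0 n) (FreeGroup.mk ((none, e) :: T)) := by
      rw [hmk, map_mul, sub_indep _ (fgx1 n) A hA]
    rw [e1, e2] at heq
    simp only [phi, inv_one, one_mul, mul_one]
    rw [← mul_assoc (subNone n (fgx1 n) (FreeGroup.mk A)), ← heq]
    group)
  have hfin := congrArg (retr n) main
  have hx1 : retr n (fgx1 n) = FreeGroup.mk [(none, true)] := by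
    simp [retr, fgx1]; rfl
  rw [map_mul, map_mul, map_inv, retr_sub, retr_sub, hx1] at hfin
  have hs2 : FreeGroup.mk s =
      FreeGroup.mk (A ++ [(none, true)] ++ FreeGroup.invRev A) := by
    rw [← FreeGroup.mul_mk, ← FreeGroup.mul_mk, ← FreeGroup.inv_mk, eq_mul_inv_iff_mul_eq,
      ← mul_inv_eq_iff_eq_mul]
    exact hfin
  have hs3 := congrArg FreeGroup.toWord hs2
  rw [FreeGroup.toWord_mk, FreeGroup.toWord_mk, hr.reduce_eq] at hs3
  have hsub : s.Sublist (A ++ [(none, true)] ++ FreeGroup.invRev A) := by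
    rw [hs3]
    exact FreeGroup.Red.sublist FreeGroup.reduce.red
  have hA' : ∀ p ∈ FreeGroup.invRev A, p.1 ≠ none := by
    intro p hp
    simp only [FreeGroup.invRev, List.mem_reverse, List.mem_map] at hp
    obtain ⟨q, hq, rfl⟩ := hp
    exact hA q hq
  constructor
  · refine (hsub.countP_le).trans ?_
    have c1 : A.countP (fun p => decide (p.1 = none)) = 0 :=
      List.countP_eq_zero.2 fun p hp => by simpa using hA p hp
    have c2 : (FreeGroup.invRev A).countP (fun p => decide (p.1 = none)) = 0 :=
      List.countP_eq_zero.2 fun p hp => by simpa using hA' p hp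
    rw [List.countP_append, List.countP_append, c1, c2]
    simp
  · intro p hp hpn
    have := hsub.subset hp
    simp only [List.mem_append, List.mem_singleton] at this
    rcases this with (h | h) | h
    · exact absurd hpn (hA p h)
    · rw [h]
    · exact absurd hpn (hA' p h)
end

section
/- Substitution of a conjugated generator in the rack translation: let X ⊆ X' be sets with designated x ∈ X and x_0, x_1 ∈ X' \\ X, and let t be a rack term over X. If E(t)₁ = x, then E(t[(x_0 ◁ x_1)/x])₁ = x_0 and E(t[(x_0 ◁ x_1)/x])₂ = x_1 · E(t)₂[x_1⁻¹·x_0·x_1/x], and E(t[(x_0 ◁⁻¹ x_1)/x])₁ = x_0 and E(t[(x_0 ◁⁻¹ x_1)/x])₂ = x_1⁻¹ · E(t)₂[x_1·x_0·x_1⁻¹/x]. If E(t)₁ ≠ x, then E(t[(x_0 ◁^ε x_1)/x])₁ = E(t)₁ for ε = ±1, and E(t[(x_0 ◁ x_1)/x])₂ = E(t)₂[x_1⁻¹·x_0·x_1/x] and E(t[(x_0 ◁⁻¹ x_1)/x])₂ = E(t)₂[x_1·x_0·x_1⁻¹/x]. -/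
/-- Closed terms over the signature of racks/quandles, with one generator
constant for each element of `X`, and two binary operations `tri` (`◁`) and
`triInv` (`◁⁻¹`). -/
inductive RackTerm (X : Type) : Type
  | gen : X → RackTerm X
  | tri : RackTerm X → RackTerm X → RackTerm X
  | triInv : RackTerm X → RackTerm X → RackTerm X

namespace RackTerm

/-- `a ◁^ε b`: `◁` when `ε = true` (exponent `+1`), `◁⁻¹` when `ε = false`
(exponent `-1`). -/
def triE {X : Type} (ε : Bool) (a b : RackTerm X) : RackTerm X :=
  if ε then a.tri b else a.triInv b

/-- Simultaneous substitution of terms for generator constants. -/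
def bind {X Y : Type} : RackTerm X → (X → RackTerm Y) → RackTerm Y
  | gen x, f => f x
  | tri a b, f => (a.bind f).tri (b.bind f)
  | triInv a b, f => (a.bind f).triInv (b.bind f)

/-- `t.subst x s` is `t[s/x]`: the substitution of `s` for every occurrence of
the generator `x` in `t`. -/
def subst {X : Type} [DecidableEq X] (t : RackTerm X) (x : X) (s : RackTerm X) : RackTerm X :=
  t.bind fun a => if a = x then s else gen a

/-- The left-associated chain `t ◁^{ε₁} z₁ ◁^{ε₂} ⋯ ◁^{εₘ} zₘ`, where the word
is the list of pairs `(zⱼ, εⱼ)`. -/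
def chain {X : Type} (t : RackTerm X) : List (X × Bool) → RackTerm X
  | [] => t
  | p :: l => chain (t.triE p.2 (gen p.1)) l

/-- The leftmost generator of a term. -/
def left {X : Type} : RackTerm X → X
  | gen x => x
  | tri a _ => a.left
  | triInv a _ => a.left

end RackTerm

/-- The rack translation `E` from rack terms over `X` to `X × FreeGroup X`:
`E(x) = (x, 1)` and, for `ε = ±1`,
`E(s ◁^ε t) = (E(s)₁, E(s)₂ · E(t)₂⁻¹ · (E(t)₁)^ε · E(t)₂)`. -/
def Erk {X : Type} : RackTerm X → X × FreeGroup X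
  | .gen x => (x, 1)
  | .tri s t =>
      ((Erk s).1, (Erk s).2 * (Erk t).2⁻¹ * FreeGroup.of (Erk t).1 * (Erk t).2)
  | .triInv s t =>
      ((Erk s).1, (Erk s).2 * (Erk t).2⁻¹ * (FreeGroup.of (Erk t).1)⁻¹ * (Erk t).2)

/-- The substitution homomorphism `w ↦ w[g/x]` from `FreeGroup X` to
`FreeGroup X'` (along `ι : X → X'`), sending the generator `x` to `g` and
every other generator `a` to `ι a`. -/
def fgSubst {X X' : Type} [DecidableEq X] (ι : X → X') (x : X) (g : FreeGroup X') :
    FreeGroup X →* FreeGroup X' :=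
  FreeGroup.lift fun a => if a = x then g else FreeGroup.of (ι a)

/-- The term substitution `t ↦ t[s/x]` from rack terms over `X` to rack terms
over `X'` (along `ι : X → X'`), substituting `s` for the generator `x` and
sending every other generator `a` to the generator `ι a`. -/
def termSubst {X X' : Type} [DecidableEq X] (ι : X → X') (x : X) (s : RackTerm X')
    (t : RackTerm X) : RackTerm X' :=
  t.bind fun a => if a = x then s else .gen (ι a)

/-- General substitution formula: substituting an arbitrary term `s`. -/
theorem Erk_termSubst_aux {X X' : Type} [DecidableEq X] (ι : X → X') (x : X)
    (s : RackTerm X') (t : RackTerm X) :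
    (Erk (termSubst ι x s t)).1 = (if (Erk t).1 = x then (Erk s).1 else ι (Erk t).1) ∧
    (Erk (termSubst ι x s t)).2 = (if (Erk t).1 = x then (Erk s).2 else 1) *
      fgSubst ι x ((Erk s).2⁻¹ * FreeGroup.of (Erk s).1 * (Erk s).2) (Erk t).2 := by
  induction t with
  | gen a =>
    by_cases h : a = x <;> simp [termSubst, RackTerm.bind, Erk, h]
  | tri a b iha ihb =>
    obtain ⟨ha1, ha2⟩ := iha
    obtain ⟨hb1, hb2⟩ := ihb
    simp only [termSubst] at ha1 ha2 hb1 hb2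
    refine ⟨ha1, ?_⟩
    simp only [termSubst, RackTerm.bind, Erk, ha2, hb1, hb2, map_mul, map_inv]
    by_cases h : (Erk b).1 = x <;> by_cases h' : (Erk a).1 = x <;>
      simp [h, h', fgSubst, mul_assoc]
  | triInv a b iha ihb =>
    obtain ⟨ha1, ha2⟩ := iha
    obtain ⟨hb1, hb2⟩ := ihb
    simp only [termSubst] at ha1 ha2 hb1 hb2
    refine ⟨ha1, ?_⟩
    simp only [termSubst, RackTerm.bind, Erk, ha2, hb1, hb2, map_mul, map_inv]
    by_cases h : (Erk b).1 = x <;> by_cases h' : (Erk a).1 = x <;>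
      simp [h, h', fgSubst, mul_assoc]

/-- **Lemma 4 of the paper.** Let `ι : X ↪ X'` realize `X ⊆ X'`, with a
designated `x ∈ X` and with `x₀, x₁ ∈ X' \ X`, and let `t` be a rack term
over `X`.  If `E(t)₁ = x`, then `E(t[(x₀ ◁^ε x₁)/x])₁ = x₀` for `ε = ±1`, and
`E(t[(x₀ ◁ x₁)/x])₂ = x₁ · E(t)₂[x₁⁻¹·x₀·x₁/x]` and
`E(t[(x₀ ◁⁻¹ x₁)/x])₂ = x₁⁻¹ · E(t)₂[x₁·x₀·x₁⁻¹/x]`.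
If `E(t)₁ ≠ x`, then `E(t[(x₀ ◁^ε x₁)/x])₁ = E(t)₁` for `ε = ±1`, and
`E(t[(x₀ ◁ x₁)/x])₂ = E(t)₂[x₁⁻¹·x₀·x₁/x]` and
`E(t[(x₀ ◁⁻¹ x₁)/x])₂ = E(t)₂[x₁·x₀·x₁⁻¹/x]`. -/
theorem rack_translation_subst_conj {X X' : Type} [DecidableEq X] (ι : X ↪ X')
    (x : X) (x0 x1 : X') (hx0 : x0 ∉ Set.range ι) (hx1 : x1 ∉ Set.range ι)
    (t : RackTerm X) :
    ((Erk t).1 = x →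
      ((Erk (termSubst ι x ((RackTerm.gen x0).tri (.gen x1)) t)).1 = x0 ∧
       (Erk (termSubst ι x ((RackTerm.gen x0).tri (.gen x1)) t)).2 =
         FreeGroup.of x1 *
           fgSubst ι x ((FreeGroup.of x1)⁻¹ * FreeGroup.of x0 * FreeGroup.of x1)
             (Erk t).2 ∧
       (Erk (termSubst ι x ((RackTerm.gen x0).triInv (.gen x1)) t)).1 = x0 ∧
       (Erk (termSubst ι x ((RackTerm.gen x0).triInv (.gen x1)) t)).2 =
         (FreeGroup.of x1)⁻¹ *
           fgSubst ι x (FreeGroup.of x1 * FreeGroup.of x0 * (FreeGroup.of x1)⁻¹)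
             (Erk t).2)) ∧
    ((Erk t).1 ≠ x →
      ((∀ ε : Bool,
          (Erk (termSubst ι x ((RackTerm.gen x0).triE ε (.gen x1)) t)).1 =
            ι (Erk t).1) ∧
       (Erk (termSubst ι x ((RackTerm.gen x0).tri (.gen x1)) t)).2 =
         fgSubst ι x ((FreeGroup.of x1)⁻¹ * FreeGroup.of x0 * FreeGroup.of x1)
           (Erk t).2 ∧
       (Erk (termSubst ι x ((RackTerm.gen x0).triInv (.gen x1)) t)).2 =
         fgSubst ι x (FreeGroup.of x1 * FreeGroup.of x0 * (FreeGroup.of x1)⁻¹)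
           (Erk t).2)) := by
  have h1 := Erk_termSubst_aux ι x ((RackTerm.gen x0).tri (.gen x1)) t
  have h2 := Erk_termSubst_aux ι x ((RackTerm.gen x0).triInv (.gen x1)) t
  have e1 : Erk ((RackTerm.gen x0).tri (.gen x1)) = (x0, FreeGroup.of x1) := by simp [Erk]
  have e2 : Erk ((RackTerm.gen x0).triInv (.gen x1)) = (x0, (FreeGroup.of x1)⁻¹) := by
    simp [Erk]
  rw [e1] at h1
  rw [e2] at h2
  simp only [inv_inv] at h1 h2
  constructor
  · intro h
    simp only [if_pos h] at h1 h2
    exact ⟨h1.1, h1.2, h2.1, h2.2⟩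
  · intro h
    simp only [if_neg h, one_mul] at h1 h2
    refine ⟨?_, h1.2, h2.2⟩
    intro ε
    cases ε
    · exact h2.1
    · exact h1.1
end

section
/- Canonical form lemma for the rack translation: let t be the left-associated rack term z_0 ◁^{ε_1} z_1 ◁^{ε_2} … ◁^{ε_m} z_m over a set X, where all z_k ∈ X and ε_j ∈ {1, −1}. Then E(t)₁ = z_0 and E(t)₂ = z_1^{ε_1} · z_2^{ε_2} ⋯ z_m^{ε_m} in FreeGroup X. -/
theorem Erk_chain_aux {X : Type} (l : List (X × Bool)) (t : RackTerm X) :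
    (Erk (t.chain l)).1 = (Erk t).1 ∧
    (Erk (t.chain l)).2 = (Erk t).2 *
      (l.map fun p => FreeGroup.of p.1 ^ (if p.2 then (1 : ℤ) else -1)).prod := by
  induction l generalizing t with
  | nil => simp [RackTerm.chain]
  | cons p l ih =>
    obtain ⟨x, b⟩ := p
    obtain ⟨h1, h2⟩ := ih (t.triE b (RackTerm.gen x))
    simp only [RackTerm.chain, h1, h2]
    cases b <;> simp [RackTerm.triE, Erk, mul_assoc]

/-- **Canonical form lemma for the rack translation** (Lemma 5 of the paper).
Let `t` be the left-associated rack term `z₀ ◁^{ε₁} z₁ ◁^{ε₂} ⋯ ◁^{εₘ} zₘ`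
over `X` (given by the starting generator `z₀` and the word
`l = [(z₁, ε₁), …, (zₘ, εₘ)]`).  Then `E(t)₁ = z₀` and
`E(t)₂ = z₁^{ε₁} · z₂^{ε₂} ⋯ zₘ^{εₘ}` in `FreeGroup X`. -/
theorem rack_translation_canonical_form {X : Type} (z0 : X) (l : List (X × Bool)) :
    (Erk ((RackTerm.gen z0).chain l)).1 = z0 ∧
    (Erk ((RackTerm.gen z0).chain l)).2 =
      (l.map fun p => FreeGroup.of p.1 ^ (if p.2 then (1 : ℤ) else -1)).prod := by
  simpa [Erk] using Erk_chain_aux l (RackTerm.gen z0)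
end

section
/- Main substitution lemma for the rack translation: let X be a set with designated element x ∈ X, let t' be a rack term over X with E(t')₁ = x, and let t be the left-associated term x ◁^{ε_1} z_1 ◁^{ε_2} … ◁^{ε_m} z_m with all z_j ∈ X and ε_j ∈ {1, −1}. Set W(t') := E(t')₂⁻¹ · x · E(t')₂ ∈ FreeGroup X. Then E(t[t'/x])₁ = x and E(t[t'/x])₂ = E(t')₂ · E(t)₂[W(t')/x]. -/
/-- **Main substitution lemma for the rack translation** (Lemma 6 of the
paper).  Let `X` be a set with a designated element `x`, let `t'` be a rack
term over `X` with `E(t')₁ = x`, and let `t` be the left-associated term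
`x ◁^{ε₁} z₁ ◁^{ε₂} ⋯ ◁^{εₘ} zₘ` (given by the word
`l = [(z₁, ε₁), …, (zₘ, εₘ)]`).  With `W(t') = E(t')₂⁻¹ · x · E(t')₂`, we have
`E(t[t'/x])₁ = x` and `E(t[t'/x])₂ = E(t')₂ · E(t)₂[W(t')/x]`, where
`-[W(t')/x]` is the group endomorphism of `FreeGroup X` sending the generator
`x` to `W(t')` and every other generator to itself. -/
theorem rack_translation_subst_main {X : Type} [DecidableEq X] (x : X)
    (t' : RackTerm X) (ht' : (Erk t').1 = x) (l : List (X × Bool)) :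
    (Erk (((RackTerm.gen x).chain l).subst x t')).1 = x ∧
    (Erk (((RackTerm.gen x).chain l).subst x t')).2 =
      (Erk t').2 *
        (FreeGroup.lift fun a =>
            if a = x then (Erk t').2⁻¹ * FreeGroup.of x * (Erk t').2
            else FreeGroup.of a)
          (Erk ((RackTerm.gen x).chain l)).2 := by
  suffices H : ∀ (l : List (X × Bool)) (s : RackTerm X),
      ((Erk (s.subst x t')).1 = x ∧
        (Erk (s.subst x t')).2 = (Erk t').2 *
          (FreeGroup.lift fun a =>
            if a = x then (Erk t').2⁻¹ * FreeGroup.of x * (Erk t').2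
            else FreeGroup.of a) (Erk s).2) →
      ((Erk ((s.chain l).subst x t')).1 = x ∧
        (Erk ((s.chain l).subst x t')).2 = (Erk t').2 *
          (FreeGroup.lift fun a =>
            if a = x then (Erk t').2⁻¹ * FreeGroup.of x * (Erk t').2
            else FreeGroup.of a) (Erk (s.chain l)).2) by
    apply H
    simp [RackTerm.subst, RackTerm.bind, Erk, ht']
  intro l
  induction l with
  | nil => intro s h; exact h
  | cons p l ih =>
    intro s h
    apply ih
    obtain ⟨z, e⟩ := p
    obtain ⟨h1, h2⟩ := h
    simp only [RackTerm.subst] at h1 h2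
    by_cases hz : z = x
    · cases e <;>
        simp [RackTerm.triE, RackTerm.subst, RackTerm.bind, Erk, h1, h2, hz, ht', mul_assoc]
    · cases e <;>
        simp [RackTerm.triE, RackTerm.subst, RackTerm.bind, Erk, h1, h2, hz, mul_assoc]
end

section
/- Let n ≥ 0 and let s be a reduced word over the generators {x, y_1, …, y_n}. In the free group on {x_0, x_1, y_1, …, y_n}, let r be the unique reduced word representing x_1 · s[x_1⁻¹·x_0·x_1/x]. Then: (i) if s is the empty word, r ends with the letter x_1; (ii) if s ends with the letter x (exponent +1), r ends with the two letters x_0, x_1; (iii) if s ends with the letter x⁻¹, r ends with the two letters x_0⁻¹, x_1; (iv) if s ends with a letter y_i^ε (i ∈ {1, …, n}, ε = ±1), then r ends with the letter x_1 followed by a nonempty reduced word over {y_1, …, y_n} that ends with y_i^ε. -/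
abbrev rweVal (n : ℕ) (s : List (XY n × Bool)) : FreeGroup (XXY n) :=
  fgx1 n * subNone n ((fgx1 n)⁻¹ * fgx0 n * fgx1 n) (FreeGroup.mk s)

lemma rweVal_nil (n : ℕ) : rweVal n [] = FreeGroup.mk [(Sum.inl true, true)] := by
  have : (FreeGroup.mk [] : FreeGroup (XY n)) = 1 := rfl
  simp only [rweVal, this, map_one, mul_one]
  rfl

lemma rweVal_none (n : ℕ) (s : List (XY n × Bool)) (e : Bool) :
    rweVal n (s ++ [(none, e)]) = rweVal n s *
      FreeGroup.mk [(Sum.inl true, false), (Sum.inl false, e), (Sum.inl true, true)] := by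
  have h : subNone n ((fgx1 n)⁻¹ * fgx0 n * fgx1 n) (FreeGroup.mk [(none, e)]) =
      FreeGroup.mk [(Sum.inl true, false), (Sum.inl false, e), (Sum.inl true, true)] := by
    cases e <;> simp [subNone, fgx1, fgx0, FreeGroup.of, FreeGroup.invRev]
  rw [rweVal, ← FreeGroup.mul_mk, map_mul, h]
  exact (mul_assoc _ _ _).symm

lemma rweVal_some (n : ℕ) (s : List (XY n × Bool)) (i : Fin n) (e : Bool) :
    rweVal n (s ++ [(some i, e)]) = rweVal n s * FreeGroup.mk [(Sum.inr i, e)] := by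
  have h : subNone n ((fgx1 n)⁻¹ * fgx0 n * fgx1 n) (FreeGroup.mk [(some i, e)]) =
      FreeGroup.mk [(Sum.inr i, e)] := by
    cases e <;> simp [subNone, FreeGroup.of, FreeGroup.invRev]
  rw [rweVal, ← FreeGroup.mul_mk, map_mul, h]
  exact (mul_assoc _ _ _).symm

lemma rwe_inv (n : ℕ) (s : List (XY n × Bool)) (hs : FreeGroup.IsReduced s) :
    ∃ r w : List (XXY n × Bool),
      FreeGroup.IsReduced (r ++ (Sum.inl true, true) :: w) ∧
      rweVal n s = FreeGroup.mk (r ++ (Sum.inl true, true) :: w) ∧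
      (∀ p ∈ w, ∃ j : Fin n, p.1 = Sum.inr j) ∧
      (s.getLast? = none → w = [] ∧ r = []) ∧
      (∀ e, s.getLast? = some (none, e) → w = [] ∧ ∃ r1, r = r1 ++ [(Sum.inl false, e)]) ∧
      (∀ i e, s.getLast? = some (some i, e) → w.getLast? = some (Sum.inr i, e)) := by
  induction s using List.reverseRecOn with
  | nil => exact ⟨[], [], by simp, rweVal_nil n, by simp, by simp, by simp, by simp⟩
  | append_singleton s a ih =>
    have hs' := List.isChain_append.1 hs
    obtain ⟨r, w, hR, hv, hw, h0, h1, h2⟩ := ih hs'.1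
    have hl := hs'.2.2
    obtain ⟨a, e⟩ := a
    rcases a with _ | i
    · rw [rweVal_none, hv]
      rcases hq : s.getLast? with _ | ⟨_ | j, e'⟩
      · obtain ⟨rfl, rfl⟩ := h0 hq
        refine ⟨[(Sum.inl false, e)], [], by simp [FreeGroup.IsReduced], ?_, by simp, by simp, ?_, by simp⟩
        · rw [FreeGroup.mul_mk]
          exact Quot.sound (FreeGroup.Red.Step.not (L₁ := []))
        · intro e1 h
          simp at h
          subst h
          exact ⟨rfl, [], rfl⟩
      · obtain ⟨rfl, r1, rfl⟩ := h1 _ hq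
        have : e' = e := by simpa [hq] using hl
        subst this
        refine ⟨r1 ++ [(Sum.inl false, e')] ++ [(Sum.inl false, e')], [], ?_, ?_, by simp, by simp, ?_, by simp⟩
        · have := hR
          simp only [FreeGroup.IsReduced, List.append_assoc, List.isChain_append] at this ⊢
          simpa using this
        · rw [FreeGroup.mul_mk]
          have := Quot.sound (FreeGroup.Red.Step.not (L₁ := r1 ++ [(Sum.inl false, e')])
            (L₂ := [((Sum.inl false : XXY n), e'), (Sum.inl true, true)]) (x := Sum.inl true) (b := true))
          simp only [List.append_assoc, List.cons_append, List.nil_append] at this ⊢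
          exact this
        · intro e1 h
          simp at h
          subst h
          exact ⟨rfl, _, rfl⟩
      · have hwl := h2 _ _ hq
        refine ⟨r ++ (Sum.inl true, true) :: w ++ [(Sum.inl true, false), (Sum.inl false, e)], [], ?_, ?_, by simp, by simp, ?_, by simp⟩
        · rw [List.append_assoc]
          refine List.isChain_append.2 ⟨hR, by simp, ?_⟩
          intro x hx y hy
          simp [hwl, List.getLast?_cons] at hx hy
          subst hx hy
          simp
        · rw [FreeGroup.mul_mk]; simp
        · intro e1 h
          simp at h
          subst h
          exact ⟨rfl, r ++ (Sum.inl true, true) :: w ++ [(Sum.inl true, false)], by simp⟩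
    · rw [rweVal_some, hv]
      refine ⟨r, w ++ [(Sum.inr i, e)], ?_, ?_, ?_, by simp, by simp, by simp⟩
      · have : r ++ (Sum.inl true, true) :: (w ++ [(Sum.inr i, e)])
          = (r ++ (Sum.inl true, true) :: w) ++ [(Sum.inr i, e)] := by simp
        rw [this]
        refine List.isChain_append.2 ⟨hR, by simp, ?_⟩
        intro x hx y hy
        simp at hy
        subst hy
        rcases hq : s.getLast? with _ | ⟨_ | j, e'⟩
        · obtain ⟨rfl, rfl⟩ := h0 hq
          simp at hx; subst hx; simp
        · obtain ⟨rfl, r1, rfl⟩ := h1 _ hq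
          simp at hx; subst hx; simp
        · have hwl := h2 _ _ hq
          simp [hwl, List.getLast?_cons] at hx
          subst hx
          simpa [hq] using hl
      · rw [FreeGroup.mul_mk]; simp
      · intro p hp
        rcases List.mem_append.1 hp with hp | hp
        · exact hw p hp
        · simp at hp; subst hp; exact ⟨i, rfl⟩

/-- **Lemma 7 of the paper.** Let `s` be a reduced word over the generators
`{x, y₁, …, yₙ}`, and in the free group on `{x₀, x₁, y₁, …, yₙ}` let `r` be
the unique reduced word representing `x₁ · s[x₁⁻¹·x₀·x₁/x]`.  Then:
(i) if `s` is empty, `r` ends with the letter `x₁`;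
(ii) if `s` ends with the letter `x`, `r` ends with the letters `x₀ x₁`;
(iii) if `s` ends with the letter `x⁻¹`, `r` ends with the letters `x₀⁻¹ x₁`;
(iv) if `s` ends with a letter `yᵢ^ε`, then `r` ends with the letter `x₁`
followed by a nonempty reduced word over `{y₁, …, yₙ}` ending with `yᵢ^ε`. -/
theorem reduced_word_ending (n : ℕ) (s : List (XY n × Bool))
    (hred : ReducedWord s) :
    (s = [] →
      ∃ r₀, (fgx1 n * subNone n ((fgx1 n)⁻¹ * fgx0 n * fgx1 n) (FreeGroup.mk s)).toWord =
        r₀ ++ [((Sum.inl true : XXY n), true)]) ∧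
    (∀ s₀, s = s₀ ++ [(none, true)] →
      ∃ r₀, (fgx1 n * subNone n ((fgx1 n)⁻¹ * fgx0 n * fgx1 n) (FreeGroup.mk s)).toWord =
        r₀ ++ [((Sum.inl false : XXY n), true), ((Sum.inl true : XXY n), true)]) ∧
    (∀ s₀, s = s₀ ++ [(none, false)] →
      ∃ r₀, (fgx1 n * subNone n ((fgx1 n)⁻¹ * fgx0 n * fgx1 n) (FreeGroup.mk s)).toWord =
        r₀ ++ [((Sum.inl false : XXY n), false), ((Sum.inl true : XXY n), true)]) ∧
    (∀ s₀ (i : Fin n) (ε : Bool), s = s₀ ++ [(some i, ε)] →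
      ∃ (r₀ : List (XXY n × Bool)) (w : List (XXY n × Bool)),
        (fgx1 n * subNone n ((fgx1 n)⁻¹ * fgx0 n * fgx1 n) (FreeGroup.mk s)).toWord =
          r₀ ++ ((Sum.inl true : XXY n), true) :: w ∧
        w ≠ [] ∧ ReducedWord w ∧ (∀ p ∈ w, ∃ j : Fin n, p.1 = Sum.inr j) ∧
        w.getLast? = some ((Sum.inr i : XXY n), ε)) := by
  obtain ⟨r, w, hR, hv, hw, h0, h1, h2⟩ := rwe_inv n s hred
  have hword : (fgx1 n * subNone n ((fgx1 n)⁻¹ * fgx0 n * fgx1 n) (FreeGroup.mk s)).toWord =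
      r ++ (Sum.inl true, true) :: w := by
    rw [show fgx1 n * subNone n ((fgx1 n)⁻¹ * fgx0 n * fgx1 n) (FreeGroup.mk s) = _ from hv,
      FreeGroup.toWord_mk]
    exact hR.reduce_eq
  rw [hword]
  refine ⟨?_, ?_, ?_, ?_⟩
  · rintro rfl
    obtain ⟨rfl, rfl⟩ := h0 rfl
    exact ⟨[], rfl⟩
  · rintro s₀ rfl
    obtain ⟨rfl, r1, rfl⟩ := h1 true (by simp)
    exact ⟨r1, by simp⟩
  · rintro s₀ rfl
    obtain ⟨rfl, r1, rfl⟩ := h1 false (by simp)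
    exact ⟨r1, by simp⟩
  · rintro s₀ i ε rfl
    have hl := h2 i ε (by simp)
    refine ⟨r, w, rfl, ?_, ?_, hw, hl⟩
    · rintro rfl
      simp at hl
    · exact (List.isChain_append.1 hR).2.1.tail
end

section
/- Let n ≥ 0 and let s be a reduced word over the generators {x, y_1, …, y_n}. If in the free group on {x_0, x_1, y_1, …, y_n} the equality x_1 · s[x_1⁻¹·x_0·x_1/x] = s[x_0/x] · s[x_1/x]⁻¹ · x_1 · s[x_1/x] holds, then in the word s every letter whose generator is x occurs before every letter whose generator lies in {y_1, …, y_n}. -/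
lemma commute_letters {α : Type} [DecidableEq α] (a : α) : ∀ w : List (α × Bool), FreeGroup.IsReduced w →
    FreeGroup.mk w * FreeGroup.of a = FreeGroup.of a * FreeGroup.mk w → ∀ p ∈ w, p.1 = a := by
  intro w
  induction w with
  | nil => simp
  | cons q w ih =>
    intro hr hc
    obtain ⟨b, e⟩ := q
    have hw : FreeGroup.IsReduced w := by
      unfold FreeGroup.IsReduced at hr ⊢
      exact List.IsChain.of_cons hr
    by_cases hb : b = a
    · subst hb
      have h1 : FreeGroup.mk ((b, e) :: w) = FreeGroup.mk [(b, e)] * FreeGroup.mk w := by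
        rw [FreeGroup.mul_mk]; rfl
      have h2 : FreeGroup.mk [(b, e)] * FreeGroup.of b = FreeGroup.of b * FreeGroup.mk [(b, e)] := by
        cases e
        · have : FreeGroup.mk [(b, false)] = (FreeGroup.of b)⁻¹ := rfl
          rw [this]; simp
        · rfl
      have h3 := ih hw (by
        rw [h1, ← mul_assoc, ← h2, mul_assoc, mul_assoc] at hc
        exact mul_left_cancel hc)
      intro p hp
      rcases List.mem_cons.1 hp with rfl | hp
      · rfl
      · exact h3 p hp
    · exfalso
      have h1 : FreeGroup.IsReduced ((a, true) :: (b, e) :: w) := by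
        unfold FreeGroup.IsReduced at hr ⊢
        exact List.IsChain.cons_cons (fun h => absurd h.symm hb) hr
      have h2 : FreeGroup.mk (((b, e) :: w) ++ [(a, true)])
          = FreeGroup.mk ((a, true) :: (b, e) :: w) := by
        rw [← FreeGroup.mul_mk]
        refine hc.trans ?_
        rw [FreeGroup.of, FreeGroup.mul_mk]; rfl
      have h3 := FreeGroup.reduce.sound h2
      rw [h1.reduce_eq] at h3
      have h4 : FreeGroup.Red (((b, e) :: w) ++ [(a, true)]) ((a, true) :: (b, e) :: w) := by
        rw [← h3]; exact FreeGroup.reduce.red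
      have h5 := h4.sublist.eq_of_length (by simp)
      simp only [List.cons_append, List.cons.injEq, Prod.mk.injEq] at h5
      exact hb h5.1.1.symm

/-- The endomorphism killing `x`. -/
def killX (n : ℕ) : FreeGroup (XY n) →* FreeGroup (XY n) :=
  FreeGroup.lift fun a => a.elim 1 fun i => FreeGroup.of (some i)

lemma killX_letters (n : ℕ) (g : FreeGroup (XY n)) :
    ∀ p ∈ (killX n g).toWord, p.1 ≠ none := by
  induction g using FreeGroup.induction_on with
  | C1 => simp
  | of a => cases a <;> simp [killX]
  | inv_of a _ => cases a <;> simp [killX, FreeGroup.toWord_inv, FreeGroup.invRev]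
  | mul g h hg hh =>
    intro p hp
    rw [map_mul] at hp
    have := (FreeGroup.toWord_mul_sublist _ _).subset hp
    rcases List.mem_append.1 this with h | h
    · exact hg p h
    · exact hh p h

/-- Set `x₀ = 1` and `x₁ = x`. -/
def collapse (n : ℕ) : FreeGroup (XXY n) →* FreeGroup (XY n) :=
  FreeGroup.lift fun a => a.elim (fun c => if c then FreeGroup.of none else 1)
    fun i => FreeGroup.of (some i)

lemma collapse_kill (n : ℕ) (g : FreeGroup (XXY n)) (hg : collapse n g = 1)
    (S : FreeGroup (XY n)) : collapse n (subNone n g S) = killX n S := by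
  have : (collapse n).comp (subNone n g) = killX n := by
    ext a
    cases a
    · simp [subNone, killX, hg]
    · simp [subNone, killX, collapse]
  rw [← this]; rfl

lemma collapse_id (n : ℕ) (S : FreeGroup (XY n)) :
    collapse n (subNone n (fgx1 n) S) = S := by
  have : (collapse n).comp (subNone n (fgx1 n)) = MonoidHom.id _ := by
    ext a
    cases a <;> simp [subNone, collapse, fgx1]
  exact DFunLike.congr_fun this S

/-- **Lemma 8 of the paper.** Let `s` be a reduced word over the generators
`{x, y₁, …, yₙ}`.  If, in the free group on `{x₀, x₁, y₁, …, yₙ}`,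
`x₁ · s[x₁⁻¹·x₀·x₁/x] = s[x₀/x] · s[x₁/x]⁻¹ · x₁ · s[x₁/x]`, then in the word
`s` every letter whose generator is `x` occurs before every letter whose
generator lies in `{y₁, …, yₙ}`. -/
theorem reduced_word_x_first (n : ℕ) (s : List (XY n × Bool))
    (hred : ReducedWord s)
    (heq : fgx1 n * subNone n ((fgx1 n)⁻¹ * fgx0 n * fgx1 n) (FreeGroup.mk s) =
      subNone n (fgx0 n) (FreeGroup.mk s) *
        (subNone n (fgx1 n) (FreeGroup.mk s))⁻¹ * fgx1 n *
        subNone n (fgx1 n) (FreeGroup.mk s)) :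
    ∀ (k l : ℕ) (hk : k < s.length) (hl : l < s.length), k < l →
      (s.get ⟨l, hl⟩).1 = none → (s.get ⟨k, hk⟩).1 = none := by
  have e0 : collapse n (fgx0 n) = 1 := by simp [collapse, fgx0]
  have e1 : collapse n (fgx1 n) = FreeGroup.of none := by simp [collapse, fgx1]
  have h := congrArg (collapse n) heq
  simp only [map_mul, map_inv] at h
  rw [collapse_kill n _ e0, collapse_id, e1, collapse_kill n _ (by simp [e0])] at h
  set S := FreeGroup.mk s with hS
  set V := killX n S with hV
  have hg : S * V⁻¹ * FreeGroup.of none = FreeGroup.of none * (S * V⁻¹) := by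
    have h' : S * V⁻¹ * (FreeGroup.of none * V) * V⁻¹ =
      S * V⁻¹ * (V * S⁻¹ * FreeGroup.of none * S) * V⁻¹ := by rw [h]
    simpa [mul_assoc] using h'
  have hW := commute_letters none (S * V⁻¹).toWord FreeGroup.isReduced_toWord
    (by rw [FreeGroup.mk_toWord]; exact hg)
  have hL := killX_letters n S
  rw [← hV] at hL
  have hred' : FreeGroup.IsReduced s := hred
  have hs : s = (S * V⁻¹).toWord ++ V.toWord := by
    have hr : FreeGroup.IsReduced ((S * V⁻¹).toWord ++ V.toWord) := by
      have r1 : FreeGroup.IsReduced (S * V⁻¹).toWord := FreeGroup.isReduced_toWord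
      have r2 : FreeGroup.IsReduced V.toWord := FreeGroup.isReduced_toWord
      unfold FreeGroup.IsReduced at r1 r2 ⊢
      refine List.IsChain.append r1 r2 ?_
      intro p hp q hq hpq
      exact absurd (hpq ▸ hW p (List.mem_of_mem_getLast? hp)) (hL q (List.mem_of_mem_head? hq))
    rw [← hred'.reduce_eq, ← hr.reduce_eq]
    apply FreeGroup.reduce.sound
    rw [← FreeGroup.mul_mk, FreeGroup.mk_toWord, FreeGroup.mk_toWord, ← hS]
    simp
  clear_value S V
  subst hs
  intro k l hk hl hkl hn
  rw [List.get_eq_getElem] at hn ⊢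
  by_cases hlt : l < (S * V⁻¹).toWord.length
  · have hk' : k < (S * V⁻¹).toWord.length := hkl.trans hlt
    simp only [List.getElem_append_left hk']
    exact hW _ (List.getElem_mem _)
  · simp only [List.getElem_append_right (not_lt.1 hlt)] at hn
    exact absurd hn (hL _ (List.getElem_mem _))
end
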